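/- For all sets F1 and F2 of nonbasic features, N(F1) ≤path N(F2) if and only if F1 ⊆ F̄2. -/

import Mathlib

namespace NavGraph

/-- The nonbasic features of the navigational algebra. -/
inductive Feature : Type
  | di | conv | inter | diff | proj | coproj
  deriving DecidableEq

/-- A graph over the label set `Λ`: it assigns to each label a binary relation
on the infinite universe of nodes (here `ℕ`). -/
def Graph (Λ : Type) : Type := Λ → Set (ℕ × ℕ)

/-- The active domain of a graph. -/
def adom {Λ : Type} (G : Graph Λ) : Set ℕ :=
  {m | ∃ n : ℕ, ∃ R : Λ, (m, n) ∈ G R ∨ (n, m) ∈ G R}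

/-- A graph is finite if each of its relations is finite. -/
def Graph.Finite {Λ : Type} (G : Graph Λ) : Prop := ∀ R : Λ, Set.Finite (G R)

/-- Expressions of the navigational algebra (with all nonbasic features). -/
inductive Expr (Λ : Type) : Type
  | rel (R : Λ)
  | empty
  | id
  | comp (e₁ e₂ : Expr Λ)
  | union (e₁ e₂ : Expr Λ)
  | di
  | conv (e : Expr Λ)
  | inter (e₁ e₂ : Expr Λ)
  | diff (e₁ e₂ : Expr Λ)
  | proj1 (e : Expr Λ)
  | proj2 (e : Expr Λ)
  | coproj1 (e : Expr Λ)
  | coproj2 (e : Expr Λ)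

/-- Semantics of expressions on graphs. -/
def eval {Λ : Type} : Expr Λ → Graph Λ → Set (ℕ × ℕ)
  | .rel R, G => G R
  | .empty, _ => ∅
  | .id, G => {p | p.1 = p.2 ∧ p.1 ∈ adom G}
  | .comp e₁ e₂, G => {p | ∃ z : ℕ, (p.1, z) ∈ eval e₁ G ∧ (z, p.2) ∈ eval e₂ G}
  | .union e₁ e₂, G => eval e₁ G ∪ eval e₂ G
  | .di, G => {p | p.1 ∈ adom G ∧ p.2 ∈ adom G ∧ p.1 ≠ p.2}
  | .conv e, G => {p | (p.2, p.1) ∈ eval e G}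
  | .inter e₁ e₂, G => eval e₁ G ∩ eval e₂ G
  | .diff e₁ e₂, G => eval e₁ G \ eval e₂ G
  | .proj1 e, G => {p | p.1 = p.2 ∧ p.1 ∈ adom G ∧ ∃ n : ℕ, (p.1, n) ∈ eval e G}
  | .proj2 e, G => {p | p.1 = p.2 ∧ p.1 ∈ adom G ∧ ∃ n : ℕ, (n, p.1) ∈ eval e G}
  | .coproj1 e, G => {p | p.1 = p.2 ∧ p.1 ∈ adom G ∧ ¬ ∃ n : ℕ, (p.1, n) ∈ eval e G}
  | .coproj2 e, G => {p | p.1 = p.2 ∧ p.1 ∈ adom G ∧ ¬ ∃ n : ℕ, (n, p.1) ∈ eval e G}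

/-- `e.InFrag F` holds if `e` is an expression of the language `N(F)`, i.e. it
only uses the basic operators and nonbasic features from `F`. -/
def Expr.InFrag {Λ : Type} (F : Set Feature) : Expr Λ → Prop
  | .rel _ => True
  | .empty => True
  | .id => True
  | .comp e₁ e₂ => e₁.InFrag F ∧ e₂.InFrag F
  | .union e₁ e₂ => e₁.InFrag F ∧ e₂.InFrag F
  | .di => Feature.di ∈ F
  | .conv e => Feature.conv ∈ F ∧ e.InFrag F
  | .inter e₁ e₂ => Feature.inter ∈ F ∧ e₁.InFrag F ∧ e₂.InFrag F
  | .diff e₁ e₂ => Feature.diff ∈ F ∧ e₁.InFrag F ∧ e₂.InFrag F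
  | .proj1 e => Feature.proj ∈ F ∧ e.InFrag F
  | .proj2 e => Feature.proj ∈ F ∧ e.InFrag F
  | .coproj1 e => Feature.coproj ∈ F ∧ e.InFrag F
  | .coproj2 e => Feature.coproj ∈ F ∧ e.InFrag F

/-- Membership in the closure `F̄` of a set of nonbasic features. -/
inductive InClosure (F : Set Feature) : Feature → Prop
  | base {x : Feature} : x ∈ F → InClosure F x
  | proj_of_coproj : InClosure F .coproj → InClosure F .proj
  | proj_of_inter_di : InClosure F .inter → InClosure F .di → InClosure F .proj
  | proj_of_inter_conv : InClosure F .inter → InClosure F .conv → InClosure F .proj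
  | coproj_of_diff_proj : InClosure F .diff → InClosure F .proj → InClosure F .coproj
  | inter_of_diff : InClosure F .diff → InClosure F .inter

/-- The closure `F̄` of a set of nonbasic features. -/
def closure (F : Set Feature) : Set Feature := {x | InClosure F x}

open Classical in
/-- The set `F̃`: replace converse by projection when converse is available but
intersection is not. -/
noncomputable def tilde (F : Set Feature) : Set Feature :=
  if Feature.conv ∈ closure F ∧ Feature.inter ∉ closure F then
    (F \ {Feature.conv}) ∪ {Feature.proj}
  else F

/-- `N(F₁) ≤path N(F₂)`: every path query expressible in `N(F₁)` is expressible
in `N(F₂)`. -/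
def leqPath (Λ : Type) (F₁ F₂ : Set Feature) : Prop :=
  ∀ e₁ : Expr Λ, e₁.InFrag F₁ →
    ∃ e₂ : Expr Λ, e₂.InFrag F₂ ∧ ∀ G : Graph Λ, eval e₂ G = eval e₁ G

/-- `N(F₁) ≤bool N(F₂)`: every boolean query expressible in `N(F₁)` is
expressible in `N(F₂)`. -/
def leqBool (Λ : Type) (F₁ F₂ : Set Feature) : Prop :=
  ∀ e₁ : Expr Λ, e₁.InFrag F₁ →
    ∃ e₂ : Expr Λ, e₂.InFrag F₂ ∧
      ∀ G : Graph Λ, ((eval e₂ G).Nonempty ↔ (eval e₁ G).Nonempty)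

/-- Strong separability at the level of boolean queries. -/
def StrongSepBool (Λ : Type) (F₁ F₂ : Set Feature) : Prop :=
  ∃ (e₁ : Expr Λ) (G₁ G₂ : Graph Λ), e₁.InFrag F₁ ∧ G₁.Finite ∧ G₂.Finite ∧
    (eval e₁ G₁).Nonempty ∧ ¬ (eval e₁ G₂).Nonempty ∧
    ∀ e₂ : Expr Λ, e₂.InFrag F₂ → ((eval e₂ G₁).Nonempty ↔ (eval e₂ G₂).Nonempty)

/-- Strong separability at the level of path queries. -/
def StrongSepPath (Λ : Type) (F₁ F₂ : Set Feature) : Prop :=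
  ∃ (e₁ : Expr Λ) (G : Graph Λ), e₁.InFrag F₁ ∧ G.Finite ∧
    ∀ e₂ : Expr Λ, e₂.InFrag F₂ → eval e₂ G ≠ eval e₁ G

/-- The `n`-fold composition `R ∘ ⋯ ∘ R` (with `R⁰ = id`). -/
def rpow {Λ : Type} (R : Λ) : ℕ → Expr Λ
  | 0 => .id
  | n + 1 => .comp (.rel R) (rpow R n)

/-- The degree of an expression: the maximum depth of nested applications of
composition, projection and coprojection. -/
def degree {Λ : Type} : Expr Λ → ℕ
  | .rel _ => 0
  | .empty => 0
  | .id => 0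
  | .di => 0
  | .comp e₁ e₂ => max (degree e₁) (degree e₂) + 1
  | .union e₁ e₂ => max (degree e₁) (degree e₂)
  | .conv e => degree e
  | .inter e₁ e₂ => max (degree e₁) (degree e₂)
  | .diff e₁ e₂ => max (degree e₁) (degree e₂)
  | .proj1 e => degree e + 1
  | .proj2 e => degree e + 1
  | .coproj1 e => degree e + 1
  | .coproj2 e => degree e + 1

end NavGraph

namespace NavGraph

/-! ### Sufficiency: the closure rules are simulations -/

theorem eval_subset_adom {Λ : Type} (e : Expr Λ) (G : Graph Λ) {m n : ℕ}
    (h : (m, n) ∈ eval e G) : m ∈ adom G ∧ n ∈ adom G := by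
  induction e generalizing m n with
  | rel R => exact ⟨⟨n, R, Or.inl h⟩, ⟨m, R, Or.inr h⟩⟩
  | empty => exact h.elim
  | id => obtain ⟨h₁, h₂⟩ := h; dsimp only at h₁ h₂; subst h₁; exact ⟨h₂, h₂⟩
  | comp e₁ e₂ ih₁ ih₂ => obtain ⟨z, h₁, h₂⟩ := h; exact ⟨(ih₁ h₁).1, (ih₂ h₂).2⟩
  | union e₁ e₂ ih₁ ih₂ => exact h.elim ih₁ ih₂
  | di => exact ⟨h.1, h.2.1⟩
  | conv e ih => exact (ih h).symm
  | inter e₁ e₂ ih₁ _ => exact ih₁ h.1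
  | diff e₁ e₂ ih₁ _ => exact ih₁ h.1
  | proj1 e | proj2 e | coproj1 e | coproj2 e =>
    obtain ⟨h₁, h₂, -⟩ := h; dsimp only at h₁ h₂; subst h₁; exact ⟨h₂, h₂⟩

/-- The path query defined by `e` is expressible in `N(F)`. -/
def Definable {Λ : Type} (F : Set Feature) (e : Expr Λ) : Prop :=
  ∃ e' : Expr Λ, e'.InFrag F ∧ ∀ G : Graph Λ, eval e' G = eval e G

/-- The queries expressible in `N(F)` are closed under the operators of the feature. -/
def Supports (Λ : Type) (F : Set Feature) : Feature → Prop
  | .di => Definable F (.di : Expr Λ)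
  | .conv => ∀ e : Expr Λ, Definable F e → Definable F (.conv e)
  | .inter => ∀ e₁ e₂ : Expr Λ, Definable F e₁ → Definable F e₂ → Definable F (.inter e₁ e₂)
  | .diff => ∀ e₁ e₂ : Expr Λ, Definable F e₁ → Definable F e₂ → Definable F (.diff e₁ e₂)
  | .proj => ∀ e : Expr Λ, Definable F e → Definable F (.proj1 e) ∧ Definable F (.proj2 e)
  | .coproj => ∀ e : Expr Λ, Definable F e → Definable F (.coproj1 e) ∧ Definable F (.coproj2 e)

section Definable

variable {Λ : Type} {F : Set Feature} {e e₁ e₂ : Expr Λ}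

theorem Definable.congr (h : Definable F e₁) (he : ∀ G : Graph Λ, eval e₁ G = eval e₂ G) :
    Definable F e₂ := by
  obtain ⟨e', hF, h'⟩ := h
  exact ⟨e', hF, fun G => (h' G).trans (he G)⟩

theorem Definable.id : Definable F (.id : Expr Λ) := ⟨.id, trivial, fun _ => rfl⟩

theorem Definable.comp (h₁ : Definable F e₁) (h₂ : Definable F e₂) :
    Definable F (.comp e₁ e₂) := by
  obtain ⟨a, ha, ha'⟩ := h₁
  obtain ⟨b, hb, hb'⟩ := h₂
  exact ⟨.comp a b, ⟨ha, hb⟩, fun G => by simp only [eval, ha', hb']⟩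

theorem Definable.union (h₁ : Definable F e₁) (h₂ : Definable F e₂) :
    Definable F (.union e₁ e₂) := by
  obtain ⟨a, ha, ha'⟩ := h₁
  obtain ⟨b, hb, hb'⟩ := h₂
  exact ⟨.union a b, ⟨ha, hb⟩, fun G => by simp only [eval, ha', hb']⟩

theorem supports_of_mem {x : Feature} (hx : x ∈ F) : Supports Λ F x := by
  cases x with
  | di => exact ⟨.di, hx, fun _ => rfl⟩
  | conv =>
    rintro e ⟨a, ha, ha'⟩
    exact ⟨.conv a, ⟨hx, ha⟩, fun G => by simp only [eval, ha']⟩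
  | inter =>
    rintro e₁ e₂ ⟨a, ha, ha'⟩ ⟨b, hb, hb'⟩
    exact ⟨.inter a b, ⟨hx, ha, hb⟩, fun G => by simp only [eval, ha', hb']⟩
  | diff =>
    rintro e₁ e₂ ⟨a, ha, ha'⟩ ⟨b, hb, hb'⟩
    exact ⟨.diff a b, ⟨hx, ha, hb⟩, fun G => by simp only [eval, ha', hb']⟩
  | proj =>
    rintro e ⟨a, ha, ha'⟩
    exact ⟨⟨.proj1 a, ⟨hx, ha⟩, fun G => by simp only [eval, ha']⟩,
      ⟨.proj2 a, ⟨hx, ha⟩, fun G => by simp only [eval, ha']⟩⟩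
  | coproj =>
    rintro e ⟨a, ha, ha'⟩
    exact ⟨⟨.coproj1 a, ⟨hx, ha⟩, fun G => by simp only [eval, ha']⟩,
      ⟨.coproj2 a, ⟨hx, ha⟩, fun G => by simp only [eval, ha']⟩⟩

theorem supports_of_inClosure {x : Feature} (hx : InClosure F x) : Supports Λ F x := by
  induction hx with
  | base hx => exact supports_of_mem hx
  | proj_of_coproj _ ih =>
    refine fun e he => ⟨(ih _ (ih e he).1).1.congr fun G => ?_,
      (ih _ (ih e he).2).1.congr fun G => ?_⟩ <;>
    · ext ⟨m, n⟩
      simp only [eval, Set.mem_ofPred_eq]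
      grind
  | proj_of_inter_di _ _ ihi ihd =>
    have total := Definable.union (Definable.id (Λ := Λ)) ihd
    refine fun e he => ⟨(ihi _ _ (he.comp total) .id).congr fun G => ?_,
      (ihi _ _ (total.comp he) .id).congr fun G => ?_⟩ <;>
    · ext ⟨m, n⟩
      have := @eval_subset_adom Λ e G
      simp only [eval, Set.mem_ofPred_eq, Set.mem_inter_iff, Set.mem_union]
      grind
  | proj_of_inter_conv _ _ ihi ihc =>
    refine fun e he => ⟨(ihi _ _ (he.comp (ihc e he)) .id).congr fun G => ?_,
      (ihi _ _ ((ihc e he).comp he) .id).congr fun G => ?_⟩ <;>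
    · ext ⟨m, n⟩
      simp only [eval, Set.mem_ofPred_eq, Set.mem_inter_iff]
      grind
  | coproj_of_diff_proj _ _ ihd ihp =>
    refine fun e he => ⟨(ihd _ _ .id (ihp e he).1).congr fun G => ?_,
      (ihd _ _ .id (ihp e he).2).congr fun G => ?_⟩ <;>
    · ext ⟨m, n⟩
      simp only [eval, Set.mem_ofPred_eq, Set.mem_sdiff]
      grind
  | inter_of_diff _ ih =>
    exact fun e₁ e₂ h₁ h₂ => (ih _ _ h₁ (ih _ _ h₁ h₂)).congr fun G => Set.sdiff_sdiff_right_self _ _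

theorem definable_of_inFrag {F' : Set Feature} (hF : F' ⊆ closure F) (he : e.InFrag F') :
    Definable F e := by
  have key {x : Feature} (hx : x ∈ F') : Supports Λ F x := supports_of_inClosure (hF hx)
  induction e with
  | rel R => exact ⟨.rel R, trivial, fun _ => rfl⟩
  | empty => exact ⟨.empty, trivial, fun _ => rfl⟩
  | id => exact .id
  | comp e₁ e₂ ih₁ ih₂ => exact (ih₁ he.1).comp (ih₂ he.2)
  | union e₁ e₂ ih₁ ih₂ => exact (ih₁ he.1).union (ih₂ he.2)
  | di => exact key he
  | conv e ih => exact key he.1 e (ih he.2)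
  | inter e₁ e₂ ih₁ ih₂ => exact key he.1 e₁ e₂ (ih₁ he.2.1) (ih₂ he.2.2)
  | diff e₁ e₂ ih₁ ih₂ => exact key he.1 e₁ e₂ (ih₁ he.2.1) (ih₂ he.2.2)
  | proj1 e ih => exact (key he.1 e (ih he.2)).1
  | proj2 e ih => exact (key he.1 e (ih he.2)).2
  | coproj1 e ih => exact (key he.1 e (ih he.2)).1
  | coproj2 e ih => exact (key he.1 e (ih he.2)).2

end Definable

/-! ### Necessity: invariants of the relations definable on a fixed graph -/

/-- A property of relations on the active domain `A` that is preserved by all operators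
of `N(F)`. -/
structure Invariant (F : Set Feature) (A : Set ℕ) (P : Set (ℕ × ℕ) → Prop) : Prop where
  empty : P ∅
  id : P {p | p.1 = p.2 ∧ p.1 ∈ A}
  comp : ∀ S T, P S → P T → P {p | ∃ z : ℕ, (p.1, z) ∈ S ∧ (z, p.2) ∈ T}
  union : ∀ S T, P S → P T → P (S ∪ T)
  di : Feature.di ∈ F → P {p | p.1 ∈ A ∧ p.2 ∈ A ∧ p.1 ≠ p.2}
  conv : Feature.conv ∈ F → ∀ S, P S → P {p | (p.2, p.1) ∈ S}
  inter : Feature.inter ∈ F → ∀ S T, P S → P T → P (S ∩ T)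
  diff : Feature.diff ∈ F → ∀ S T, P S → P T → P (S \ T)
  proj1 : Feature.proj ∈ F → ∀ S, P S → P {p | p.1 = p.2 ∧ p.1 ∈ A ∧ ∃ n : ℕ, (p.1, n) ∈ S}
  proj2 : Feature.proj ∈ F → ∀ S, P S → P {p | p.1 = p.2 ∧ p.1 ∈ A ∧ ∃ n : ℕ, (n, p.1) ∈ S}
  coproj1 : Feature.coproj ∈ F → ∀ S, P S →
    P {p | p.1 = p.2 ∧ p.1 ∈ A ∧ ¬ ∃ n : ℕ, (p.1, n) ∈ S}
  coproj2 : Feature.coproj ∈ F → ∀ S, P S →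
    P {p | p.1 = p.2 ∧ p.1 ∈ A ∧ ¬ ∃ n : ℕ, (n, p.1) ∈ S}

theorem Invariant.eval {Λ : Type} {F : Set Feature} {G : Graph Λ} {P : Set (ℕ × ℕ) → Prop}
    (h : Invariant F (adom G) P) (hrel : ∀ R, P (G R)) {e : Expr Λ} (he : e.InFrag F) :
    P (eval e G) := by
  induction e with
  | rel R => exact hrel R
  | empty => exact h.empty
  | id => exact h.id
  | comp e₁ e₂ ih₁ ih₂ => exact h.comp _ _ (ih₁ he.1) (ih₂ he.2)
  | union e₁ e₂ ih₁ ih₂ => exact h.union _ _ (ih₁ he.1) (ih₂ he.2)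
  | di => exact h.di he
  | conv e ih => exact h.conv he.1 _ (ih he.2)
  | inter e₁ e₂ ih₁ ih₂ => exact h.inter he.1 _ _ (ih₁ he.2.1) (ih₂ he.2.2)
  | diff e₁ e₂ ih₁ ih₂ => exact h.diff he.1 _ _ (ih₁ he.2.1) (ih₂ he.2.2)
  | proj1 e ih => exact h.proj1 he.1 _ (ih he.2)
  | proj2 e ih => exact h.proj2 he.1 _ (ih he.2)
  | coproj1 e ih => exact h.coproj1 he.1 _ (ih he.2)
  | coproj2 e ih => exact h.coproj2 he.1 _ (ih he.2)

/-- The graph in which every label denotes the relation `E`. -/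
def constGraph (Λ : Type) (E : Set (ℕ × ℕ)) : Graph Λ := fun _ => E

/-- The nodes incident to an edge of `E`. -/
def field (E : Set (ℕ × ℕ)) : Set ℕ := {m | ∃ n : ℕ, (m, n) ∈ E ∨ (n, m) ∈ E}

theorem adom_constGraph {Λ : Type} [Nonempty Λ] (E : Set (ℕ × ℕ)) :
    adom (constGraph Λ E) = field E := by
  ext m
  simp [adom, constGraph, field]

theorem not_definable_of_invariant {Λ : Type} [Nonempty Λ] {F : Set Feature} {E : Set (ℕ × ℕ)}
    {P : Set (ℕ × ℕ) → Prop} {e : Expr Λ} (h : Invariant F (field E) P) (hE : P E)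
    (he : ¬ P (eval e (constGraph Λ E))) : ¬ Definable F e := by
  rintro ⟨e', hF, h'⟩
  rw [← adom_constGraph (Λ := Λ)] at h
  exact he (h' (constGraph Λ E) ▸ h.eval (fun _ => hE) hF)

/-- Relations closed under a simulation `Z` between pairs of nodes form an invariant, provided
that every intermediate node can be matched. -/
theorem Invariant.of_simulation {F : Set Feature} (Z : ℕ → ℕ → ℕ → ℕ → Prop)
    (eq_iff : ∀ x y x' y', Z x y x' y' → (x = y ↔ x' = y'))
    (split : ∀ x y x' y', Z x y x' y' → ∀ z, ∃ z', Z x z x' z' ∧ Z z y z' y')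
    (swap : Feature.conv ∈ F → ∀ x y x' y', Z x y x' y' → Z y x y' x')
    (symm : Feature.diff ∈ F → ∀ x y x' y', Z x y x' y' → Z x' y' x y)
    (symm_diag : Feature.coproj ∈ F → ∀ x x', Z x x x' x' → Z x' x' x x) :
    Invariant F Set.univ
      fun S => ∀ x y x' y', Z x y x' y' → (x, y) ∈ S → (x', y') ∈ S where
  empty _ _ _ _ _ h := h
  id x y x' y' hs h := ⟨(eq_iff _ _ _ _ hs).1 h.1, trivial⟩
  comp := by
    rintro S T hS hT x y x' y' hs ⟨z, h₁, h₂⟩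
    obtain ⟨z', hz₁, hz₂⟩ := split _ _ _ _ hs z
    exact ⟨z', hS _ _ _ _ hz₁ h₁, hT _ _ _ _ hz₂ h₂⟩
  union S T hS hT x y x' y' hs := Or.imp (hS _ _ _ _ hs) (hT _ _ _ _ hs)
  di _ x y x' y' hs h := ⟨trivial, trivial, fun h' => h.2.2 ((eq_iff _ _ _ _ hs).2 h')⟩
  conv hc S hS x y x' y' hs := hS _ _ _ _ (swap hc _ _ _ _ hs)
  inter _ S T hS hT x y x' y' hs := And.imp (hS _ _ _ _ hs) (hT _ _ _ _ hs)
  diff hd S T hS hT x y x' y' hs :=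
    And.imp (hS _ _ _ _ hs) (mt (hT _ _ _ _ (symm hd _ _ _ _ hs)))
  proj1 := by
    rintro - S hS x y x' y' hs ⟨h₁, -, n, hn⟩
    obtain ⟨n', hn', -⟩ := split _ _ _ _ hs n
    exact ⟨(eq_iff _ _ _ _ hs).1 h₁, trivial, n', hS _ _ _ _ hn' hn⟩
  proj2 := by
    rintro - S hS x y x' y' hs ⟨h₁, -, n, hn⟩
    have h₁' := (eq_iff _ _ _ _ hs).1 h₁
    dsimp only at h₁ h₁'
    subst h₁ h₁'
    obtain ⟨n', -, hn'⟩ := split _ _ _ _ hs n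
    exact ⟨rfl, trivial, n', hS _ _ _ _ hn' hn⟩
  coproj1 := by
    rintro hc S hS x y x' y' hs ⟨h₁, -, hno⟩
    have h₁' := (eq_iff _ _ _ _ hs).1 h₁
    dsimp only at h₁ h₁'
    subst h₁ h₁'
    refine ⟨rfl, trivial, ?_⟩
    rintro ⟨n, hn⟩
    obtain ⟨n', hn', -⟩ := split _ _ _ _ (symm_diag hc _ _ hs) n
    exact hno ⟨n', hS _ _ _ _ hn' hn⟩
  coproj2 := by
    rintro hc S hS x y x' y' hs ⟨h₁, -, hno⟩
    have h₁' := (eq_iff _ _ _ _ hs).1 h₁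
    dsimp only at h₁ h₁'
    subst h₁ h₁'
    refine ⟨rfl, trivial, ?_⟩
    rintro ⟨n, hn⟩
    obtain ⟨n', -, hn'⟩ := split _ _ _ _ (symm_diag hc _ _ hs) n
    exact hno ⟨n', hS _ _ _ _ hn' hn⟩

section Separation

variable {Λ : Type} [Nonempty Λ] {F : Set Feature}

theorem not_definable_di (h : Feature.di ∉ F) : ¬ Definable F (.di : Expr Λ) := by
  have hA : field {p : ℕ × ℕ | p.1 = p.2} = Set.univ := by
    ext m; simp [field]
  refine not_definable_of_invariant (E := {p | p.1 = p.2})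
    (P := fun S => ∀ m n, (m, n) ∈ S → m = n) ?_ ?_ ?_
  · rw [hA]
    constructor <;> grind
  · simp
  · intro hP
    simpa [eval, adom_constGraph, hA] using hP 0 1

/-- A dense irreflexive digraph: `x → y` depends on the parity of `x` and on the second binary
digit of `y`, which can be prescribed independently. -/
def parityRel : Set (ℕ × ℕ) := {p | p.1 ≠ p.2 ∧ p.1 % 2 ≠ p.2 / 2 % 2}

theorem parityRel_extension (x y : ℕ) (a b : Prop) :
    ∃ z, x ≠ z ∧ z ≠ y ∧ ((x, z) ∈ parityRel ↔ a) ∧ ((z, y) ∈ parityRel ↔ b) := by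
  have main (u v : ℕ) (hu : u < 2) (hv : v < 2) : ∃ z, x ≠ z ∧ z ≠ y ∧ z / 2 % 2 = u ∧ z % 2 = v :=
    ⟨4 * (x + y + 1) + 2 * u + v, by omega, by omega, by omega, by omega⟩
  simp only [parityRel, Set.mem_ofPred_eq]
  by_cases ha : a <;> by_cases hb : b
  · obtain ⟨z, h⟩ := main (1 - x % 2) (1 - y / 2 % 2) (by omega) (by omega)
    exact ⟨z, by simp only [ha, hb, iff_true]; omega⟩
  · obtain ⟨z, h⟩ := main (1 - x % 2) (y / 2 % 2) (by omega) (by omega)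
    exact ⟨z, by simp only [ha, hb, iff_true, iff_false]; omega⟩
  · obtain ⟨z, h⟩ := main (x % 2) (1 - y / 2 % 2) (by omega) (by omega)
    exact ⟨z, by simp only [ha, hb, iff_true, iff_false]; omega⟩
  · obtain ⟨z, h⟩ := main (x % 2) (y / 2 % 2) (by omega) (by omega)
    exact ⟨z, by simp only [ha, hb, iff_false]; omega⟩

/-- Two pairs agree on the atomic formulas `x = y` and `x → y`. -/
def SameType (x y x' y' : ℕ) : Prop :=
  (x = y ↔ x' = y') ∧ ((x, y) ∈ parityRel ↔ (x', y') ∈ parityRel)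

theorem SameType.split {x y x' y' : ℕ} (h : SameType x y x' y') (z : ℕ) :
    ∃ z', SameType x z x' z' ∧ SameType z y z' y' := by
  have irrefl (w : ℕ) : (w, w) ∉ parityRel := by simp [parityRel]
  unfold SameType at *
  by_cases hx : x = z
  · subst hx; exact ⟨x', by simp [irrefl], h⟩
  by_cases hy : z = y
  · subst hy; exact ⟨y', h, by simp [irrefl]⟩
  obtain ⟨z', h₁, h₂, h₃, h₄⟩ := parityRel_extension x' y' ((x, z) ∈ parityRel) ((z, y) ∈ parityRel)
  exact ⟨z', by simp [hx, h₁, h₃], by simp [hy, h₂, h₄]⟩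

theorem SameType.symm {x y x' y' : ℕ} (h : SameType x y x' y') : SameType x' y' x y :=
  ⟨h.1.symm, h.2.symm⟩

theorem field_parityRel : field parityRel = Set.univ := by
  ext m
  obtain ⟨z, -, -, h, -⟩ := parityRel_extension m m True True
  simpa [field] using ⟨z, Or.inl (h.2 trivial)⟩

theorem not_definable_conv (h : Feature.conv ∉ F) (R : Λ) :
    ¬ Definable F (.conv (.rel R) : Expr Λ) := by
  refine not_definable_of_invariant (E := parityRel) (field_parityRel ▸
    Invariant.of_simulation SameType (fun _ _ _ _ hs => hs.1) (fun _ _ _ _ hs => hs.split)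
      (fun h' => absurd h' h) (fun _ _ _ _ _ => SameType.symm) fun _ _ _ => SameType.symm) ?_ ?_
  · exact fun x y x' y' hs => hs.2.1
  · intro hP
    have := hP 1 5 0 2 (by simp [SameType, parityRel]) (by simp [eval, constGraph, parityRel])
    simp [eval, constGraph, parityRel] at this

theorem not_definable_inter (hi : Feature.inter ∉ F) (hd : Feature.diff ∉ F) (R : Λ) :
    ¬ Definable F (.inter (.rel R) .id : Expr Λ) := by
  have hE (x : ℕ) : (x, x + 1) ∈ {p : ℕ × ℕ | p.1 ≠ p.2 ∨ p.1 = 0} ∧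
      (x + 1, x) ∈ {p : ℕ × ℕ | p.1 ≠ p.2 ∨ p.1 = 0} := by simp
  have hA : field {p : ℕ × ℕ | p.1 ≠ p.2 ∨ p.1 = 0} = Set.univ := by
    ext m
    simpa only [Set.mem_univ, iff_true] using ⟨m + 1, Or.inl (hE m).1⟩
  refine not_definable_of_invariant (E := {p | p.1 ≠ p.2 ∨ p.1 = 0})
    (P := fun S => (∀ x y, (x, y) ∉ S) ∨ ∀ x, (∃ y, (x, y) ∈ S) ∧ ∃ y, (y, x) ∈ S) ?_ ?_ ?_
  · rw [hA]
    constructor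
    case id => exact .inr fun x => ⟨⟨x, rfl, trivial⟩, ⟨x, rfl, trivial⟩⟩
    case di =>
      exact fun _ => .inr fun x => ⟨⟨x + 1, by simp⟩, ⟨x + 1, by simp⟩⟩
    case comp =>
      rintro S T (hS | hS) (hT | hT)
      case inr.inr =>
        refine .inr fun x => ⟨?_, ?_⟩
        · obtain ⟨z, hz⟩ := (hS x).1
          obtain ⟨y, hy⟩ := (hT z).1
          exact ⟨y, z, hz, hy⟩
        · obtain ⟨z, hz⟩ := (hT x).2
          obtain ⟨y, hy⟩ := (hS z).2
          exact ⟨y, z, hy, hz⟩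
      all_goals
        refine .inl ?_
        rintro x y ⟨z, h₁, h₂⟩
      exacts [hS _ _ h₁, hS _ _ h₁, hT _ _ h₂]
    case union =>
      rintro S T (hS | hS) (hT | hT)
      · exact .inl fun x y h => h.elim (hS x y) (hT x y)
      · exact .inr fun x => ⟨(hT x).1.imp fun _ => .inr, (hT x).2.imp fun _ => .inr⟩
      all_goals exact .inr fun x => ⟨(hS x).1.imp fun _ => .inl, (hS x).2.imp fun _ => .inl⟩
    case proj1 =>
      rintro - S (hS | hS)
      · exact .inl fun x y ⟨_, _, n, hn⟩ => hS _ _ hn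
      · exact .inr fun x => ⟨⟨x, rfl, trivial, (hS x).1⟩, ⟨x, rfl, trivial, (hS x).1⟩⟩
    case proj2 =>
      rintro - S (hS | hS)
      · exact .inl fun x y ⟨_, _, n, hn⟩ => hS _ _ hn
      · exact .inr fun x => ⟨⟨x, rfl, trivial, (hS x).2⟩, ⟨x, rfl, trivial, (hS x).2⟩⟩
    case coproj1 =>
      rintro - S (hS | hS)
      · exact .inr fun x => ⟨⟨x, rfl, trivial, fun ⟨n, hn⟩ => hS _ _ hn⟩,
          ⟨x, rfl, trivial, fun ⟨n, hn⟩ => hS _ _ hn⟩⟩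
      · exact .inl fun x y h => h.2.2 (hS x).1
    case coproj2 =>
      rintro - S (hS | hS)
      · exact .inr fun x => ⟨⟨x, rfl, trivial, fun ⟨n, hn⟩ => hS _ _ hn⟩,
          ⟨x, rfl, trivial, fun ⟨n, hn⟩ => hS _ _ hn⟩⟩
      · exact .inl fun x y h => h.2.2 (hS x).2
    case conv => exact fun _ S => Or.imp (fun hS x y => hS y x) fun hS x => (hS x).symm
    case empty => exact .inl fun _ _ h => h
    case inter => exact fun h => absurd h hi
    case diff => exact fun h => absurd h hd
  · exact .inr fun x => ⟨⟨x + 1, (hE x).1⟩, ⟨x + 1, (hE x).2⟩⟩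
  · rintro (hP | hP)
    · exact hP 0 0 (by simp [eval, constGraph, adom_constGraph, hA])
    · obtain ⟨⟨y, hy, hy', -⟩, -⟩ := hP 1
      simp [constGraph, eval] at hy hy'
      omega

theorem not_definable_diff (h : Feature.diff ∉ F) (R : Λ) :
    ¬ Definable F (.diff (.comp (.rel R) (.rel R)) (.rel R) : Expr Λ) := by
  have hA : field {p : ℕ × ℕ | p.1 / 2 ≠ p.2 / 2} = Set.univ := by
    ext m
    simp only [field, Set.mem_ofPred_eq, Set.mem_univ, iff_true]
    exact ⟨m + 2, by omega⟩
  refine not_definable_of_invariant (E := {p | p.1 / 2 ≠ p.2 / 2}) (P := fun S => ∀ x y x' y',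
    (x = y ↔ x' = y') ∧ (x / 2 ≠ y / 2 → x' / 2 ≠ y' / 2) → (x, y) ∈ S → (x', y') ∈ S) ?_ ?_ ?_
  · rw [hA]
    refine Invariant.of_simulation
      (fun x y x' y' => (x = y ↔ x' = y') ∧ (x / 2 ≠ y / 2 → x' / 2 ≠ y' / 2))
      (by grind) ?_ (by grind) (by grind) (by grind)
    intro x y x' y' hs z
    by_cases hx : x = z
    · exact ⟨x', by grind⟩
    by_cases hy : z = y
    · exact ⟨y', by grind⟩
    exact ⟨2 * (x' + y' + 1), by omega⟩
  · exact fun x y x' y' hs => hs.2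
  · intro hP
    have := hP 0 1 0 2 (by simp) ⟨⟨2, by simp [eval, constGraph]⟩, by simp [eval, constGraph]⟩
    simp [eval, constGraph] at this

/-- Every point related to something is related to at least two points, in both directions. -/
def Fat (S : Set (ℕ × ℕ)) : Prop :=
  ∀ x y, (x, y) ∈ S → (∃ y', y' ≠ y ∧ (x, y') ∈ S) ∧ ∃ x', x' ≠ x ∧ (x', y) ∈ S

theorem not_definable_proj_of_not_inter (hp : Feature.proj ∉ F) (hc : Feature.coproj ∉ F)
    (hi : Feature.inter ∉ F) (hd : Feature.diff ∉ F) (R : Λ) :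
    ¬ Definable F (.proj1 (.rel R) : Expr Λ) := by
  have hA : field {p : ℕ × ℕ | p.1 % 2 = 0 ∧ p.2 % 2 = 1} = Set.univ := by
    ext m
    simp only [field, Set.mem_ofPred_eq, Set.mem_univ, iff_true]
    exact ⟨m + 1, by omega⟩
  refine not_definable_of_invariant (E := {p | p.1 % 2 = 0 ∧ p.2 % 2 = 1})
    (P := fun S => (∀ x, (x, x) ∈ S) ∨ Fat S) ?_ ?_ ?_
  · rw [hA]
    constructor
    case comp =>
      rintro S T (hS | hS) (hT | hT)
      · exact .inl fun x => ⟨x, hS x, hT x⟩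
      · refine .inr ?_
        rintro x y ⟨z, h₁, h₂⟩
        obtain ⟨⟨y', hy', h₃⟩, ⟨x', hx', h₄⟩⟩ := hT _ _ h₂
        refine ⟨⟨y', hy', z, h₁, h₃⟩, ?_⟩
        by_cases hzx : z = x
        · exact ⟨x', by grind, x', hS x', h₄⟩
        · exact ⟨z, hzx, z, hS z, h₂⟩
      · refine .inr ?_
        rintro x y ⟨z, h₁, h₂⟩
        obtain ⟨⟨y', hy', h₃⟩, ⟨x', hx', h₄⟩⟩ := hS _ _ h₁
        refine ⟨?_, ⟨x', hx', z, h₄, h₂⟩⟩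
        by_cases hzy : z = y
        · exact ⟨y', by grind, y', h₃, hT y'⟩
        · exact ⟨z, hzy, z, h₁, hT z⟩
      · refine .inr ?_
        rintro x y ⟨z, h₁, h₂⟩
        obtain ⟨-, ⟨x', hx', h₃⟩⟩ := hS _ _ h₁
        obtain ⟨⟨y', hy', h₄⟩, -⟩ := hT _ _ h₂
        exact ⟨⟨y', hy', z, h₁, h₄⟩, ⟨x', hx', z, h₃, h₂⟩⟩
    case di =>
      refine fun _ => .inr fun x y _ => ⟨⟨x + y + 1, ?_⟩, ⟨x + y + 1, ?_⟩⟩ <;>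
      simp only [Set.mem_ofPred_eq, Set.mem_univ, true_and] <;> omega
    case conv => exact fun _ S => Or.imp id fun hS x y h => (hS y x h).symm
    all_goals unfold Fat; grind
  · refine .inr ?_
    rintro x y ⟨hx, hy⟩
    dsimp only at hx hy
    exact ⟨⟨y + 2, by omega, hx, by dsimp only; omega⟩, ⟨x + 2, by omega, by dsimp only; omega, hy⟩⟩
  · rintro (hP | hP)
    · obtain ⟨-, -, n, hn, -⟩ := hP 1
      simp at hn
    · obtain ⟨⟨y, hy, h, -⟩, -⟩ := hP 0 0
        ⟨rfl, by simp [adom_constGraph, hA], 1, by simp [eval, constGraph]⟩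
      exact hy h.symm

theorem field_edge : field {((0 : ℕ), (1 : ℕ))} = {0, 1} := by
  ext m
  simp only [field, Set.mem_ofPred_eq, Set.mem_singleton_iff, Prod.mk.injEq, Set.mem_insert_iff]
  exact ⟨by omega, fun h => ⟨1 - m, by omega⟩⟩

theorem invariant_of_inter_diff (hdi : Feature.di ∉ F) (hc : Feature.conv ∉ F)
    (hp : Feature.proj ∉ F) (hcp : Feature.coproj ∉ F) :
    Invariant F (field {((0 : ℕ), (1 : ℕ))}) fun S =>
      (∀ x y, (x, y) ∈ S → x ≤ y ∧ y ≤ 1) ∧ ((0, 0) ∈ S ↔ (1, 1) ∈ S) := by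
  rw [field_edge]
  constructor
  case comp =>
    rintro S T ⟨hS, hS'⟩ ⟨hT, hT'⟩
    refine ⟨?_, ?_, ?_⟩
    · rintro x y ⟨z, h₁, h₂⟩
      have := hS _ _ h₁
      have := hT _ _ h₂
      omega
    · rintro ⟨z, h₁, h₂⟩
      obtain rfl : z = 0 := by have := hT _ _ h₂; dsimp only at this; omega
      exact ⟨1, hS'.1 h₁, hT'.1 h₂⟩
    · rintro ⟨z, h₁, h₂⟩
      obtain rfl : z = 1 := by have := hS _ _ h₁; dsimp only at this; omega
      exact ⟨0, hS'.2 h₁, hT'.2 h₂⟩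
  all_goals grind

theorem not_definable_proj_of_not_di (hdi : Feature.di ∉ F) (hc : Feature.conv ∉ F)
    (hp : Feature.proj ∉ F) (hcp : Feature.coproj ∉ F) (R : Λ) :
    ¬ Definable F (.proj1 (.rel R) : Expr Λ) := by
  refine not_definable_of_invariant (invariant_of_inter_diff hdi hc hp hcp) ?_ ?_
  · simp
  · rintro ⟨-, hP⟩
    simp [eval, adom_constGraph, field_edge, constGraph] at hP

theorem not_definable_coproj_of_not_di (hdi : Feature.di ∉ F) (hc : Feature.conv ∉ F)
    (hp : Feature.proj ∉ F) (hcp : Feature.coproj ∉ F) (R : Λ) :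
    ¬ Definable F (.coproj1 (.rel R) : Expr Λ) := by
  refine not_definable_of_invariant (invariant_of_inter_diff hdi hc hp hcp) ?_ ?_
  · simp
  · rintro ⟨-, hP⟩
    simp [eval, adom_constGraph, field_edge, constGraph] at hP

theorem not_definable_coproj_of_not_diff (hc : Feature.coproj ∉ F) (hd : Feature.diff ∉ F)
    (R : Λ) : ¬ Definable F (.coproj1 (.rel R) : Expr Λ) := by
  have hA : field {p : ℕ × ℕ | p.1 ≠ 0} = Set.univ := by
    ext m
    simpa [field] using ⟨1, Or.inr one_ne_zero⟩
  refine not_definable_of_invariant (E := {p | p.1 ≠ 0}) (hA ▸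
    Invariant.of_simulation (fun x y x' y' => x' = x + 1 ∧ y' = y + 1) (by grind) (by grind)
      (by grind) (by grind) (by grind)) ?_ ?_
  · grind
  · intro hP
    have := hP 0 0 1 1 ⟨rfl, rfl⟩ (by simp [eval, adom_constGraph, hA]; simp [constGraph])
    simp [eval, constGraph] at this

end Separation

theorem subset_closure_of_leqPath {Λ : Type} [Nonempty Λ] {F₁ F₂ : Set Feature}
    (h : leqPath Λ F₁ F₂) : F₁ ⊆ closure F₂ := by
  intro x hx
  by_contra hn
  obtain ⟨R⟩ := ‹Nonempty Λ›
  have hn' : ¬ InClosure F₂ x := hn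
  have not_mem {y : Feature} (hy : ¬ InClosure F₂ y) : y ∉ F₂ := fun hy' => hy (.base hy')
  cases x with
  | di => exact not_definable_di (not_mem hn') (h .di hx)
  | conv => exact not_definable_conv (not_mem hn') R (h (.conv (.rel R)) ⟨hx, trivial⟩)
  | inter =>
    exact not_definable_inter (not_mem hn') (not_mem (mt .inter_of_diff hn')) R
      (h (.inter (.rel R) .id) ⟨hx, trivial, trivial⟩)
  | diff =>
    exact not_definable_diff (not_mem hn') R
      (h (.diff (.comp (.rel R) (.rel R)) (.rel R)) ⟨hx, ⟨trivial, trivial⟩, trivial⟩)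
  | proj =>
    have hcp := mt InClosure.proj_of_coproj hn'
    have hdef := h (.proj1 (.rel R)) ⟨hx, trivial⟩
    by_cases hi : InClosure F₂ .inter
    · exact not_definable_proj_of_not_di (not_mem (mt (.proj_of_inter_di hi) hn'))
        (not_mem (mt (.proj_of_inter_conv hi) hn')) (not_mem hn') (not_mem hcp) R hdef
    · exact not_definable_proj_of_not_inter (not_mem hn') (not_mem hcp) (not_mem hi)
        (not_mem (mt .inter_of_diff hi)) R hdef
  | coproj =>
    have hdef := h (.coproj1 (.rel R)) ⟨hx, trivial⟩
    by_cases hd : InClosure F₂ .diff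
    · have hp := mt (InClosure.coproj_of_diff_proj hd) hn'
      have hi := InClosure.inter_of_diff hd
      exact not_definable_coproj_of_not_di (not_mem (mt (.proj_of_inter_di hi) hp))
        (not_mem (mt (.proj_of_inter_conv hi) hp)) (not_mem hp) (not_mem hn') R hdef
    · exact not_definable_coproj_of_not_diff (not_mem hn') (not_mem hd) R hdef

/-- For all sets F₁ and F₂ of nonbasic features,
`N(F₁) ≤path N(F₂)` if and only if `F₁ ⊆ F̄₂`. -/
theorem path_order_characterization (Λ : Type) [Fintype Λ] [Nonempty Λ]
    (F₁ F₂ : Set Feature) :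
    leqPath Λ F₁ F₂ ↔ F₁ ⊆ closure F₂ := by
  exact ⟨subset_closure_of_leqPath, fun h _ he => definable_of_inFrag h he⟩

end NavGraph
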